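/- Let C_n^σ = (C_n, σ) be a distance compatible signed cycle on n ≥ 3 vertices. Then dim(C_n^σ) = 1 if and only if there exists a vertex u with net-degree d^±(u) = 0 such that for every k = 1, 2, …, ⌊n/2⌋ and for all distinct vertices v, w in the open k-neighbourhood N_k(u), the common shortest-path signs satisfy σ(uv) ≠ σ(uw). -/

import Mathlib

open SimpleGraph
open scoped Classical

/-- The sign of a walk: the product of the signs of its edges. -/
def SimpleGraph.walkSign {V : Type*} {G : SimpleGraph V} (σ : Sym2 V → ℤ) {u v : V}
    (p : G.Walk u v) : ℤ :=
  (p.edges.map σ).prod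

/-- σ_max: `-1` if every shortest `u–v` path has sign `-1`, and `+1` otherwise. -/
noncomputable def SimpleGraph.sigmaMax {V : Type*} (G : SimpleGraph V) (σ : Sym2 V → ℤ)
    (u v : V) : ℤ :=
  if ∀ p : G.Walk u v, p.length = G.dist u v → SimpleGraph.walkSign σ p = -1 then -1 else 1

/-- σ_min: `+1` if every shortest `u–v` path has sign `+1`, and `-1` otherwise. -/
noncomputable def SimpleGraph.sigmaMin {V : Type*} (G : SimpleGraph V) (σ : Sym2 V → ℤ)
    (u v : V) : ℤ :=
  if ∀ p : G.Walk u v, p.length = G.dist u v → SimpleGraph.walkSign σ p = 1 then 1 else -1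

/-- The signed distance `d^max`. -/
noncomputable def SimpleGraph.dmax {V : Type*} (G : SimpleGraph V) (σ : Sym2 V → ℤ)
    (u v : V) : ℤ :=
  G.sigmaMax σ u v * G.dist u v

/-- The signed distance `d^min`. -/
noncomputable def SimpleGraph.dmin {V : Type*} (G : SimpleGraph V) (σ : Sym2 V → ℤ)
    (u v : V) : ℤ :=
  G.sigmaMin σ u v * G.dist u v

/-- A signed graph `(G, σ)` is distance compatible if `d^max = d^min` for all pairs. -/
def SimpleGraph.DistCompatible {V : Type*} (G : SimpleGraph V) (σ : Sym2 V → ℤ) : Prop :=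
  ∀ u v : V, G.dmax σ u v = G.dmin σ u v

/-- The signed distance of a (distance compatible) signed graph. -/
noncomputable def SimpleGraph.sdist {V : Type*} (G : SimpleGraph V) (σ : Sym2 V → ℤ)
    (u v : V) : ℤ :=
  G.dmax σ u v

/-- `W` is a resolving set of the signed graph `(G, σ)`: distinct vertices get distinct
vectors of signed distances to the vertices of `W`. -/
def SimpleGraph.SResolves {V : Type*} (G : SimpleGraph V) (σ : Sym2 V → ℤ) (W : Set V) : Prop :=
  ∀ u v : V, (∀ w ∈ W, G.sdist σ u w = G.sdist σ v w) → u = v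

/-- `W` is a resolving set of the (unsigned) graph `G`. -/
def SimpleGraph.UResolves {V : Type*} (G : SimpleGraph V) (W : Set V) : Prop :=
  ∀ u v : V, (∀ w ∈ W, G.dist u w = G.dist v w) → u = v

/-- The metric dimension of the signed graph `(G, σ)`. -/
noncomputable def SimpleGraph.sdim {V : Type*} [Fintype V] (G : SimpleGraph V)
    (σ : Sym2 V → ℤ) : ℕ :=
  sInf {k | ∃ W : Finset V, W.card = k ∧ G.SResolves σ ↑W}

/-- The metric dimension of the (unsigned) graph `G`. -/
noncomputable def SimpleGraph.udim {V : Type*} [Fintype V] (G : SimpleGraph V) : ℕ :=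
  sInf {k | ∃ W : Finset V, W.card = k ∧ G.UResolves ↑W}

theorem SimpleGraph.walkSign_reverse {V : Type*} {G : SimpleGraph V} (σ : Sym2 V → ℤ) {u v : V}
    (p : G.Walk u v) : SimpleGraph.walkSign σ p.reverse = SimpleGraph.walkSign σ p := by
  simp [SimpleGraph.walkSign]

theorem SimpleGraph.sigmaMax_comm {V : Type*} (G : SimpleGraph V) (σ : Sym2 V → ℤ) (u v : V) :
    G.sigmaMax σ u v = G.sigmaMax σ v u := by
  unfold SimpleGraph.sigmaMax
  congr 1
  refine propext ⟨fun h p hp => ?_, fun h p hp => ?_⟩ <;>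
  · rw [← SimpleGraph.walkSign_reverse]
    exact h _ (by rw [Walk.length_reverse, hp, dist_comm])

theorem SimpleGraph.sigmaMax_eq_one_or {V : Type*} (G : SimpleGraph V) (σ : Sym2 V → ℤ) (u v : V) :
    G.sigmaMax σ u v = 1 ∨ G.sigmaMax σ u v = -1 := by
  unfold SimpleGraph.sigmaMax
  split_ifs <;> simp

theorem SimpleGraph.sdist_comm {V : Type*} (G : SimpleGraph V) (σ : Sym2 V → ℤ) (u v : V) :
    G.sdist σ u v = G.sdist σ v u := by
  unfold SimpleGraph.sdist SimpleGraph.dmax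
  rw [G.sigmaMax_comm, dist_comm]

theorem SimpleGraph.natAbs_sdist {V : Type*} (G : SimpleGraph V) (σ : Sym2 V → ℤ) (u v : V) :
    (G.sdist σ u v).natAbs = G.dist u v := by
  unfold SimpleGraph.sdist SimpleGraph.dmax
  rcases G.sigmaMax_eq_one_or σ u v with h | h <;> simp [h]

/-- The sign of an edge is the common sign of the shortest paths between its ends. -/
theorem SimpleGraph.sigmaMax_of_adj {V : Type*} {G : SimpleGraph V} {σ : Sym2 V → ℤ} {u v : V}
    (h : G.Adj u v) (hσ : σ s(u, v) = 1 ∨ σ s(u, v) = -1) :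
    G.sigmaMax σ u v = σ s(u, v) := by
  have key : ∀ p : G.Walk u v, p.length = G.dist u v → SimpleGraph.walkSign σ p = σ s(u, v) := by
    intro p hp
    rw [dist_eq_one_iff_adj.mpr h] at hp
    cases p with
    | nil => simp at hp
    | cons a q =>
      cases q with
      | nil => simp [SimpleGraph.walkSign]
      | cons b r => simp at hp
  unfold SimpleGraph.sigmaMax
  rcases hσ with hσ | hσ
  · rw [if_neg, hσ]
    intro hall
    have hp : (h.toWalk).length = G.dist u v := by simp [dist_eq_one_iff_adj.mpr h]
    have h₁ := key _ hp
    rw [hall _ hp, hσ] at h₁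
    norm_num at h₁
  · rw [if_pos, hσ]
    intro p hp
    rw [key p hp, hσ]

theorem SimpleGraph.sdist_of_adj {V : Type*} {G : SimpleGraph V} {σ : Sym2 V → ℤ} {u v : V}
    (h : G.Adj u v) (hσ : σ s(u, v) = 1 ∨ σ s(u, v) = -1) :
    G.sdist σ u v = σ s(u, v) := by
  simp [SimpleGraph.sdist, SimpleGraph.dmax, sigmaMax_of_adj h hσ, dist_eq_one_iff_adj.mpr h]

theorem SimpleGraph.sdim_eq_one_iff {V : Type*} [Fintype V] [Nontrivial V] (G : SimpleGraph V)
    (σ : Sym2 V → ℤ) : G.sdim σ = 1 ↔ ∃ u : V, Function.Injective (G.sdist σ u) := by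
  have hsing : ∀ u : V, G.SResolves σ ↑({u} : Finset V) ↔ Function.Injective (G.sdist σ u) := by
    intro u
    simp only [SimpleGraph.SResolves, Finset.coe_singleton, Set.mem_singleton_iff, forall_eq,
      G.sdist_comm σ _ u, Function.Injective]
  constructor
  · intro h
    have hne : {k | ∃ W : Finset V, W.card = k ∧ G.SResolves σ ↑W}.Nonempty :=
      Nat.nonempty_of_pos_sInf (by rw [SimpleGraph.sdim] at h; omega)
    obtain ⟨W, hW, hres⟩ := Nat.sInf_mem hne
    rw [← SimpleGraph.sdim, h] at hW
    obtain ⟨u, rfl⟩ := Finset.card_eq_one.mp hW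
    exact ⟨u, (hsing u).mp hres⟩
  · rintro ⟨u, hu⟩
    have hmem : 1 ∈ {k | ∃ W : Finset V, W.card = k ∧ G.SResolves σ ↑W} :=
      ⟨{u}, Finset.card_singleton u, (hsing u).mpr hu⟩
    refine le_antisymm (Nat.sInf_le hmem) ?_
    obtain ⟨W, hW, hres⟩ := Nat.sInf_mem ⟨1, hmem⟩
    rw [← SimpleGraph.sdim] at hW
    rw [← hW, Nat.one_le_iff_ne_zero, Ne, Finset.card_eq_zero]
    rintro rfl
    obtain ⟨a, b, hab⟩ := exists_pair_ne V
    exact hab (hres a b (by simp))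

open scoped Fin.CommRing in
theorem SimpleGraph.cycleGraph_dist_add_le {m : ℕ} (u : Fin (m + 2)) (k : ℕ) :
    (cycleGraph (m + 2)).dist u (u + (k : Fin (m + 2))) ≤ k := by
  induction k with
  | zero => simp
  | succ k ih =>
    have hadj : (cycleGraph (m + 2)).Adj (u + (k : Fin (m + 2)))
        (u + ((k + 1 : ℕ) : Fin (m + 2))) := by
      rw [cycleGraph_adj]
      right
      push_cast
      abel
    have hconn : (cycleGraph (m + 2)).Connected := cycleGraph_connected
    have := hconn.dist_triangle (u := u)
      (v := u + (k : Fin (m + 2))) (w := u + ((k + 1 : ℕ) : Fin (m + 2)))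
    rw [dist_eq_one_iff_adj.mpr hadj] at this
    omega

open scoped Fin.CommRing in
theorem SimpleGraph.cycleGraph_dist_le_half {m : ℕ} (u v : Fin (m + 2)) :
    (cycleGraph (m + 2)).dist u v ≤ (m + 2) / 2 := by
  have h₁ := cycleGraph_dist_add_le u (v - u).val
  have h₂ := cycleGraph_dist_add_le v (m + 2 - (v - u).val)
  have hlt := (v - u).isLt
  rw [Fin.cast_val_eq_self, add_sub_cancel] at h₁
  rw [Nat.cast_sub hlt.le, Fin.cast_val_eq_self, Fin.natCast_self, zero_sub, neg_sub,
    add_sub_cancel, dist_comm] at h₂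
  omega

/-- For a distance compatible signed cycle `C_n^σ` with `n ≥ 3`: `dim(C_n^σ) = 1` iff
there is a vertex `u` of net-degree `0` such that for each `k = 1, …, ⌊n/2⌋`, distinct
vertices in the open `k`-neighbourhood of `u` have different (common shortest-path)
signs towards `u`. -/
theorem sdim_signed_cycle_eq_one_iff (n : ℕ) (hn : 3 ≤ n)
    (σ : Sym2 (Fin n) → ℤ)
    (hσ : ∀ e ∈ (SimpleGraph.cycleGraph n).edgeSet, σ e = 1 ∨ σ e = -1)
    (hcomp : (SimpleGraph.cycleGraph n).DistCompatible σ) :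
    (SimpleGraph.cycleGraph n).sdim σ = 1 ↔
      ∃ u : Fin n,
        (∑ w ∈ Finset.univ.filter (fun w => (SimpleGraph.cycleGraph n).Adj u w),
            σ s(u, w)) = 0 ∧
        ∀ k : ℕ, 1 ≤ k → k ≤ n / 2 →
          ∀ v w : Fin n, (SimpleGraph.cycleGraph n).dist u v = k →
            (SimpleGraph.cycleGraph n).dist u w = k → v ≠ w →
              (SimpleGraph.cycleGraph n).sigmaMax σ u v ≠
                (SimpleGraph.cycleGraph n).sigmaMax σ u w := by
  obtain ⟨m, rfl⟩ : ∃ m, n = m + 3 := ⟨n - 3, by omega⟩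
  rw [SimpleGraph.sdim_eq_one_iff]
  refine exists_congr fun u => ⟨fun hinj => ⟨?_, ?_⟩, ?_⟩
  · have hne : u - 1 ≠ u + 1 := by
      intro h
      have h₂ : (1 : Fin (m + 3)) + 1 = 0 := by
        rw [sub_eq_iff_eq_add, add_assoc] at h
        exact left_eq_add.mp h
      have := congrArg Fin.val h₂
      simp only [Fin.val_add, Fin.val_one, Fin.val_zero] at this
      rw [Nat.mod_eq_of_lt (by omega)] at this
      omega
    have hfilter : Finset.univ.filter (fun w => (cycleGraph (m + 3)).Adj u w)
        = {u - 1, u + 1} := by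
      ext w
      simp only [Finset.mem_filter, Finset.mem_univ, true_and, Finset.mem_insert,
        Finset.mem_singleton, cycleGraph_adj]
      constructor
      · rintro (h | h)
        · left; rw [← h]; abel
        · right; rw [← h]; abel
      · rintro (rfl | rfl)
        · left; abel
        · right; abel
    have hadj : ∀ w ∈ ({u - 1, u + 1} : Finset (Fin (m + 3))),
        (cycleGraph (m + 3)).Adj u w := by
      intro w hw
      rw [← hfilter] at hw
      simpa using hw
    have ha := hadj (u - 1) (by simp)
    have hb := hadj (u + 1) (by simp)
    have hsa := hσ s(u, u - 1) ha
    have hsb := hσ s(u, u + 1) hb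
    have hσne : σ s(u, u - 1) ≠ σ s(u, u + 1) := by
      rw [← sdist_of_adj ha hsa, ← sdist_of_adj hb hsb]
      exact hinj.ne hne
    rw [hfilter, Finset.sum_pair hne]
    omega
  · intro k _ _ v w hv hw hvw hs
    exact hvw (hinj (by simp only [SimpleGraph.sdist, SimpleGraph.dmax, hs, hv, hw]))
  · rintro ⟨-, hsep⟩ v w hvw
    have hd : (cycleGraph (m + 3)).dist u v = (cycleGraph (m + 3)).dist u w := by
      rw [← natAbs_sdist _ σ, hvw, natAbs_sdist]
    by_contra hne
    have hpos : (cycleGraph (m + 3)).dist u v ≠ 0 := by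
      intro h₀
      have hconn : (cycleGraph (m + 3)).Connected := cycleGraph_connected
      exact hne ((hconn.dist_eq_zero_iff.mp h₀).symm.trans
        (hconn.dist_eq_zero_iff.mp (hd ▸ h₀)))
    refine hsep _ (Nat.one_le_iff_ne_zero.mpr hpos) (cycleGraph_dist_le_half u v) v w rfl hd.symm
      hne ?_
    simp only [SimpleGraph.sdist, SimpleGraph.dmax, ← hd] at hvw
    exact mul_right_cancel₀ (by exact_mod_cast hpos) hvw
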